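/- Let F be a finite field with q elements, with 2^r exactly dividing q²-1. Let m₁,…,m_n be positive integers, b₁,…,b_n ∈ F*, c ∈ F, a₁ = … = a_t = 0, and a_{t+1},…,a_n ∈ F*. Set d_j⁻ = gcd(m_j,q-1), d_j⁺ = gcd(m_j,q+1), and δ_j = 1 if q is odd, 2^{r-1} ∥ m_j, and a_j is a nonsquare; δ_j = 1/2 if q is odd, m_j is even, and 2^{r-1} ∤ m_j; δ_j = 0 otherwise. Assume ∑_{j=1}^t 1/d_j⁻ + (1/2)∑_{j=t+1}^n 1/d_j⁻ + (1/2 + 1/(q-1))∑_{j=t+1}^n 1/d_j⁺ > 1 + (n - t - δ_{t+1} - … - δ_n)/(q-1). If the equation b₁D_{m₁}(X₁,a₁) + … + b_nD_{m_n}(X_n,a_n) = c has a solution in Fⁿ, then it has at least two distinct solutions in Fⁿ. -/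

import Mathlib

open scoped Classical

section Scherk

open scoped Pointwise

/-- **Scherk theorem**: if `0` is represented only trivially in `A + B`, then
`|A + B| ≥ |A| + |B| - 1`. -/
theorem Finset.card_add_card_le_card_add_of_unique_zero {G : Type*} [AddCommGroup G] [Finite G]
    (A B : Finset G) (hA : 0 ∈ A) (hB : 0 ∈ B)
    (huniq : ∀ x ∈ A, ∀ y ∈ B, x + y = 0 → y = 0) :
    A.card + B.card ≤ (A + B).card + 1 := by
  induction hn : B.card using Nat.strong_induction_on generalizing A B with
  | _ k ih =>
  by_cases hex : ∃ e ∈ A, ∃ y ∈ B, e + y ∉ A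
  · obtain ⟨e, he, y, hy, hey⟩ := hex
    set P := Finset.addDysonETransform e (A, B) with hP
    have h1 : ∀ x, x ∈ P.1 ↔ x ∈ A ∨ ∃ z ∈ B, e + z = x := by
      intro x
      simp [hP, Finset.addDysonETransform, Finset.mem_vadd_finset]
    have h2 : ∀ x, x ∈ P.2 ↔ x ∈ B ∧ e + x ∈ A := by
      intro x
      simp [hP, Finset.addDysonETransform, Finset.mem_neg_vadd_finset_iff]
    have hcard : P.1.card + P.2.card = A.card + B.card := Finset.addDysonETransform.card e (A, B)
    have hsub : P.1 + P.2 ⊆ A + B := Finset.addDysonETransform.subset e (A, B)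
    have hlt : P.2.card < k := by
      rw [← hn]
      apply Finset.card_lt_card
      refine ⟨fun x hx => ((h2 x).1 hx).1, fun h => hey ((h2 y).1 (h hy)).2⟩
    have := ih _ hlt P.1 P.2 ((h1 0).2 (Or.inl hA)) ((h2 0).2 ⟨hB, by simpa using he⟩) ?_ rfl
    · have := Finset.card_le_card hsub
      omega
    · intro x hx z hz hxz
      obtain ⟨hzB, hzA⟩ := (h2 z).1 hz
      rcases (h1 x).1 hx with hx | ⟨w, hw, rfl⟩
      · exact huniq x hx z hzB hxz
      · have hw0 := huniq (e + z) hzA w hw (by rw [← hxz]; abel)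
        subst hw0
        exact huniq e he z hzB (by simpa using hxz)
  · push Not at hex
    have hB1 : B ⊆ {0} := by
      intro y hy
      have hmul : ∀ i : ℕ, i • y ∈ A := by
        intro i
        induction i with
        | zero => simpa using hA
        | succ i hi => rw [succ_nsmul]; exact hex _ hi y hy
      have hpos := (isOfFinAddOrder_of_finite y).addOrderOf_pos
      have := huniq ((addOrderOf y - 1) • y) (hmul _) y hy (by
        rw [← succ_nsmul, Nat.sub_add_cancel hpos, addOrderOf_nsmul_eq_zero])
      simpa using this
    have h1 : k ≤ 1 := by simpa [hn] using Finset.card_le_card hB1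
    have h2 : A ⊆ A + B := fun x hx => Finset.mem_add.2 ⟨x, hx, 0, hB, by simp⟩
    have := Finset.card_le_card h2
    omega

theorem Finset.sum_card_sub_one_lt_card_of_unique_zero {G ι : Type*} [AddCommGroup G] [Fintype G]
    (s : Finset ι) (A : ι → Finset G) (hA : ∀ i ∈ s, 0 ∈ A i)
    (huniq : ∀ f : ι → G, (∀ i ∈ s, f i ∈ A i) → ∑ i ∈ s, f i = 0 → ∀ i ∈ s, f i = 0) :
    ∑ i ∈ s, ((A i).card - 1) < (∑ i ∈ s, A i).card := by
  induction s using Finset.induction_on with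
  | empty => simp
  | insert i s his ih =>
    have hA' : ∀ j ∈ s, 0 ∈ A j := fun j hj => hA j (Finset.mem_insert_of_mem hj)
    have hext : ∀ x ∈ A i, ∀ f : ι → G, (∀ j ∈ s, f j ∈ A j) → x + ∑ j ∈ s, f j = 0 →
        ∀ j ∈ s, f j = 0 := by
      intro x hx f hf hsum j hj
      have hne : ∀ l ∈ s, l ≠ i := fun l hl h => his (h ▸ hl)
      have := huniq (Function.update f i x) ?_ ?_ j (Finset.mem_insert_of_mem hj)
      · rwa [Function.update_of_ne (hne j hj)] at this
      · intro l hl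
        rcases Finset.mem_insert.1 hl with rfl | hl
        · simpa using hx
        · rw [Function.update_of_ne (hne l hl)]; exact hf l hl
      · rw [Finset.sum_insert his, Function.update_self, ← hsum]
        congr 1
        exact Finset.sum_congr rfl fun l hl => Function.update_of_ne (hne l hl) _ _
    have h1 := ih hA' (fun f hf hsum => hext 0 (hA i (Finset.mem_insert_self i s)) f hf (by simpa))
    have h2 := Finset.card_add_card_le_card_add_of_unique_zero (A i) (∑ j ∈ s, A j)
      (hA i (Finset.mem_insert_self i s))
      (by
        rw [← Finset.mem_coe, Finset.coe_sum, Set.mem_finsetSum]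
        exact ⟨fun _ => 0, fun {j} hj => hA' j hj, by simp⟩) (by
        intro x hx y hy hxy
        rw [← Finset.mem_coe, Finset.coe_sum, Set.mem_finsetSum] at hy
        obtain ⟨f, hf, rfl⟩ := hy
        exact Finset.sum_eq_zero (hext x hx f (fun j hj => hf hj) hxy))
    rw [Finset.sum_insert his, Finset.sum_insert his]
    have : 0 < (A i).card := Finset.card_pos.2 ⟨0, hA i (Finset.mem_insert_self i s)⟩
    omega

end Scherk

section DicksonValueSet

open Polynomial

theorem Finset.card_le_gcd_mul_card_image_pow {K : Type*} [Field K] (S : Finset K) {c : K}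
    (hc : c ≠ 0) {N : ℕ} (m : ℕ) (hN : 0 < N) (hS : ∀ y ∈ S, y ^ N = c) :
    S.card ≤ Nat.gcd m N * (S.image (· ^ m)).card := by
  apply Finset.card_le_mul_card_image
  intro z hz
  obtain ⟨y, hy, rfl⟩ := Finset.mem_image.1 hz
  have hgcd : 0 < Nat.gcd m N := Nat.gcd_pos_of_pos_right _ hN
  have hy0 : y ≠ 0 := by
    rintro rfl
    exact hc (by rw [← hS 0 hy, zero_pow hN.ne'])
  refine le_trans ?_ ((Multiset.toFinset_card_le _).trans (card_nthRoots (Nat.gcd m N) (1 : K)))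
  apply Finset.card_le_card_of_injOn (· / y)
  · intro x hx
    obtain ⟨hxS, hxy⟩ := Finset.mem_filter.1 hx
    rw [Finset.mem_coe, Multiset.mem_toFinset, mem_nthRoots hgcd, pow_gcd_eq_one, div_pow, div_pow]
    exact ⟨by rw [hxy, div_self (pow_ne_zero _ hy0)], by rw [hS x hxS, hS y hy, div_self hc]⟩
  · intro x _ x' _ h
    exact (div_left_inj' hy0).1 h

theorem Polynomial.card_nthRoots_of_isAlgClosed {K : Type*} [Field K] [IsAlgClosed K] {n : ℕ}
    (hn : (n : K) ≠ 0) {a : K} (ha : a ≠ 0) : (nthRoots n a).toFinset.card = n := by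
  rw [nthRoots, Multiset.toFinset_card_of_nodup (nodup_roots (separable_X_pow_sub_C a hn ha)),
    ← (IsAlgClosed.splits _).natDegree_eq_card_roots, natDegree_X_pow_sub_C]

theorem Polynomial.eval_dickson_one_add_div {K : Type*} [Field K] (a : K) {y : K} (hy : y ≠ 0)
    (m : ℕ) : (dickson 1 a m).eval (y + a / y) = y ^ m + (a / y) ^ m := by
  induction m using Nat.twoStepInduction with
  | zero => simp; norm_num
  | one => simp
  | more m ih1 ih2 =>
    rw [dickson_add_two, eval_sub, eval_mul, eval_mul, ih1, ih2, eval_X, eval_C]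
    have hyw : y * (a / y) = a := mul_div_cancel₀ a hy
    generalize a / y = w at hyw
    subst hyw
    ring

theorem Finset.card_add_card_sq_eq_le {K : Type*} [Field K] (T : Finset K) (A : K)
    (hT : ∀ z ∈ T, z ≠ 0) :
    T.card + (T.filter (fun z => z ^ 2 = A)).card ≤ 2 * (T.image (fun z => z + A / z)).card := by
  have h : ∀ v ∈ T.image (fun z => z + A / z),
      ∑ z ∈ T with z + A / z = v, (1 + if z ^ 2 = A then 1 else 0) ≤ 2 := by
    intro v hv
    obtain ⟨z, hz, rfl⟩ := Finset.mem_image.1 hv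
    have hz0 := hT z hz
    have hsub : ∀ x ∈ T.filter (fun x => x + A / x = z + A / z), x = z ∨ x = A / z := by
      intro x hx
      obtain ⟨hxT, hx⟩ := Finset.mem_filter.1 hx
      have hx0 := hT x hxT
      field_simp at hx
      have : (x - z) * (x * z - A) = 0 := by linear_combination hx
      rcases mul_eq_zero.1 this with h | h
      · exact Or.inl (sub_eq_zero.1 h)
      · right
        rw [eq_div_iff hz0]
        exact sub_eq_zero.1 h
    by_cases hzA : z ^ 2 = A
    · have hs : T.filter (fun x => x + A / x = z + A / z) ⊆ {z} := by
        intro x hx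
        have : A / z = z := by rw [← hzA]; field_simp
        rcases hsub x hx with h | h <;> simp [h, this]
      refine (Finset.sum_le_sum_of_subset hs).trans ?_
      simp [hzA]
    · have hs : T.filter (fun x => x + A / x = z + A / z) ⊆ {z, A / z} := by
        intro x hx
        simpa using hsub x hx
      have hns : ∀ x ∈ T.filter (fun x => x + A / x = z + A / z), ¬ x ^ 2 = A := by
        intro x hx hxA
        rcases hsub x hx with rfl | h
        · exact hzA hxA
        · have hx0 := hT x (Finset.mem_filter.1 hx).1
          apply hzA
          have h2 : x * z = A := by rw [h]; field_simp
          have h3 : z = x := mul_left_cancel₀ hx0 (by rw [h2, ← hxA, sq])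
          rw [h3, hxA]
      rw [Finset.sum_congr rfl (g := fun _ => 1) (fun x hx => by simp [hns x hx])]
      simpa using (Finset.card_le_card hs).trans Finset.card_le_two
  have hsum := Finset.sum_fiberwise_of_maps_to
    (s := T) (t := T.image (fun z => z + A / z)) (g := fun z => z + A / z)
    (fun z hz => Finset.mem_image_of_mem _ hz) (fun z => 1 + if z ^ 2 = A then 1 else 0)
  rw [Finset.card_filter, Finset.card_eq_sum_ones, ← Finset.sum_add_distrib, ← hsum, mul_comm]
  simpa using Finset.sum_le_card_nsmul _ _ 2 h

theorem FiniteField.exists_algebraMap_eq_of_pow_card_eq {F K : Type*} [Field F] [Fintype F]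
    [Field K] [Algebra F K] {x : K} (hx : x ^ Fintype.card F = x) : ∃ u : F, algebraMap F K u = x := by
  set p : K[X] := X ^ Fintype.card F - X with hp
  have hp0 : p ≠ 0 := FiniteField.X_pow_card_sub_X_ne_zero K Fintype.one_lt_card
  have hsub : Finset.univ.image (algebraMap F K) ⊆ p.roots.toFinset := by
    intro y hy
    obtain ⟨u, -, rfl⟩ := Finset.mem_image.1 hy
    rw [Multiset.mem_toFinset, mem_roots hp0]
    simp [hp, ← map_pow, FiniteField.pow_card]
  have hle : p.roots.toFinset.card ≤ (Finset.univ.image (algebraMap F K)).card := by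
    rw [Finset.card_image_of_injective _ (algebraMap F K).injective, Finset.card_univ]
    refine (Multiset.toFinset_card_le _).trans ((card_roots' p).trans ?_)
    rw [hp, FiniteField.X_pow_card_sub_X_natDegree_eq K Fintype.one_lt_card]
  have hmem : x ∈ p.roots.toFinset := by
    rw [Multiset.mem_toFinset, mem_roots hp0]
    simp [hp, hx]
  rw [← Finset.eq_of_subset_of_card_le hsub hle] at hmem
  obtain ⟨u, -, hu⟩ := Finset.mem_image.1 hmem
  exact ⟨u, hu⟩

/-- Lower bound for the value set of a Dickson polynomial, counting the fixed points `E` of the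
involution `z ↦ aᵐ / z` which lie in exactly one of the two sets of `m`-th powers. -/
theorem FiniteField.card_image_dickson_ge {F K : Type*} [Field F] [Fintype F] [Field K]
    [IsAlgClosed K] [Algebra F K] {q : ℕ} (hq : Fintype.card F = q) {a : F} (ha : a ≠ 0) (m : ℕ)
    (E : Finset K) (hE : ∀ z ∈ E, z ^ 2 = algebraMap F K a ^ m ∧
      Xor (∃ y : K, y ^ (q - 1) = 1 ∧ y ^ m = z) (∃ y : K, y ^ (q + 1) = algebraMap F K a ∧ y ^ m = z)) :
    ((q : ℚ) - 1) / Nat.gcd m (q - 1) + ((q : ℚ) + 1) / Nat.gcd m (q + 1) + E.card ≤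
      2 * (Finset.univ.image (fun x => (dickson 1 a m).eval x)).card := by
  set α := algebraMap F K a with hα
  have hα0 : α ≠ 0 := by simpa [hα] using ha
  have hαq : α ^ q = α := by rw [hα, ← map_pow, ← hq, FiniteField.pow_card]
  have hq1 : 1 < q := hq ▸ Fintype.one_lt_card
  have hqK : (q : K) = 0 := by
    rw [← hq, ← map_natCast (algebraMap F K), FiniteField.cast_card_eq_zero, map_zero]
  have hc1 : ((q - 1 : ℕ) : K) ≠ 0 := by
    rw [Nat.cast_sub hq1.le, hqK]; simp
  have hc2 : ((q + 1 : ℕ) : K) ≠ 0 := by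
    push_cast; rw [hqK]; simp
  set S₁ := (nthRoots (q - 1) (1 : K)).toFinset with hS₁
  set S₂ := (nthRoots (q + 1) α).toFinset with hS₂
  have hm₁ : ∀ y, y ∈ S₁ ↔ y ^ (q - 1) = 1 := fun y => by
    rw [hS₁, Multiset.mem_toFinset, mem_nthRoots (by omega)]
  have hm₂ : ∀ y, y ∈ S₂ ↔ y ^ (q + 1) = α := fun y => by
    rw [hS₂, Multiset.mem_toFinset, mem_nthRoots (by omega)]
  have hk₁ : S₁.card = q - 1 := card_nthRoots_of_isAlgClosed hc1 one_ne_zero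
  have hk₂ : S₂.card = q + 1 := card_nthRoots_of_isAlgClosed hc2 hα0
  set T₁ := S₁.image (· ^ m) with hT₁
  set T₂ := S₂.image (· ^ m) with hT₂
  have ht₁ : ∀ z, z ∈ T₁ ↔ ∃ y, y ^ (q - 1) = 1 ∧ y ^ m = z := fun z => by
    simp [hT₁, hm₁]
  have ht₂ : ∀ z, z ∈ T₂ ↔ ∃ y, y ^ (q + 1) = α ∧ y ^ m = z := fun z => by
    simp [hT₂, hm₂]
  have hb₁ : q - 1 ≤ Nat.gcd m (q - 1) * T₁.card := hk₁.ge.trans <|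
    S₁.card_le_gcd_mul_card_image_pow one_ne_zero m (by omega) (fun y hy => (hm₁ y).1 hy)
  have hb₂ : q + 1 ≤ Nat.gcd m (q + 1) * T₂.card := hk₂.ge.trans <|
    S₂.card_le_gcd_mul_card_image_pow hα0 m (by omega) (fun y hy => (hm₂ y).1 hy)
  have hy₁ : ∀ y : K, y ^ (q - 1) = 1 → y ≠ 0 := by
    rintro y hy rfl
    rw [zero_pow (by omega)] at hy
    exact zero_ne_one hy
  have hy₂ : ∀ y : K, y ^ (q + 1) = α → y ≠ 0 := by
    rintro y hy rfl
    rw [zero_pow (by omega)] at hy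
    exact hα0 hy.symm
  have hvals : (T₁ ∪ T₂).image (fun z => z + α ^ m / z) ⊆
      (Finset.univ.image (fun x => (dickson 1 a m).eval x)).image (algebraMap F K) := by
    have key : ∀ y : K, y ≠ 0 → (y + α / y) ^ q = y + α / y →
        y ^ m + α ^ m / y ^ m ∈
          (Finset.univ.image (fun x => (dickson 1 a m).eval x)).image (algebraMap F K) := by
      intro y hy0 hy
      obtain ⟨u, hu⟩ := FiniteField.exists_algebraMap_eq_of_pow_card_eq (F := F) (hq ▸ hy)
      refine Finset.mem_image.2 ⟨_, Finset.mem_image_of_mem _ (Finset.mem_univ u), ?_⟩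
      rw [← div_pow, ← eval_dickson_one_add_div α hy0 m, ← hu, hα, ← map_dickson,
        eval_map_algebraMap, aeval_algebraMap_apply, coe_aeval_eq_eval]
    have hfrob : ∀ y : K, (y + α / y) ^ q = y ^ q + α / y ^ q := by
      intro y
      obtain ⟨p, hp⟩ := CharP.exists F
      obtain ⟨k, hpp, hk⟩ := FiniteField.card F p
      have := Fact.mk hpp
      have : CharP K p := charP_of_injective_algebraMap (algebraMap F K).injective p
      rw [← hαq]
      conv_lhs => rw [hαq, ← hq, hk, add_pow_char_pow, ← hk, hq, div_pow]
    intro v hv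
    obtain ⟨z, hz, rfl⟩ := Finset.mem_image.1 hv
    rcases Finset.mem_union.1 hz with hz | hz
    · obtain ⟨y, hy, rfl⟩ := (ht₁ z).1 hz
      have hyq : y ^ q = y := by
        rw [← Nat.sub_add_cancel hq1.le, pow_succ, hy, one_mul]
      exact key y (hy₁ y hy) (by rw [hfrob, hyq])
    · obtain ⟨y, hy, rfl⟩ := (ht₂ z).1 hz
      have hy0 := hy₂ y hy
      have hyq : y ^ q = α / y := by
        rw [eq_div_iff hy0, ← pow_succ, hy]
      refine key y hy0 ?_
      rw [hfrob, hyq]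
      field_simp
      ring
  have hT0 : ∀ z ∈ T₁ ∪ T₂, z ≠ 0 := by
    intro z hz
    rcases Finset.mem_union.1 hz with hz | hz
    · obtain ⟨y, hy, rfl⟩ := (ht₁ z).1 hz
      exact pow_ne_zero _ (hy₁ y hy)
    · obtain ⟨y, hy, rfl⟩ := (ht₂ z).1 hz
      exact pow_ne_zero _ (hy₂ y hy)
  have horbit := Finset.card_add_card_sq_eq_le (T₁ ∪ T₂) (α ^ m) hT0
  have hV := Finset.card_le_card hvals
  rw [Finset.card_image_of_injective _ (algebraMap F K).injective] at hV
  have hint : (T₁ ∩ T₂) ∪ E ⊆ (T₁ ∪ T₂).filter (fun z => z ^ 2 = α ^ m) := by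
    intro z hz
    rcases Finset.mem_union.1 hz with hz | hz
    · obtain ⟨hz₁, hz₂⟩ := Finset.mem_inter.1 hz
      refine Finset.mem_filter.2 ⟨Finset.mem_union_left _ hz₁, ?_⟩
      obtain ⟨y, hy, rfl⟩ := (ht₁ z).1 hz₁
      obtain ⟨y', hy', hyy⟩ := (ht₂ _).1 hz₂
      calc (y ^ m) ^ 2 = (y ^ m) ^ 2 * (y ^ (q - 1)) ^ m := by rw [hy]; simp
        _ = (y ^ m) ^ (q - 1 + 2) := by ring
        _ = (y' ^ (q + 1)) ^ m := by
          rw [show q - 1 + 2 = q + 1 by omega, ← hyy]; ring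
        _ = α ^ m := by rw [hy']
    · obtain ⟨h1, h2⟩ := hE z hz
      rw [← ht₁, ← ht₂] at h2
      exact Finset.mem_filter.2 ⟨Finset.mem_union.2 (xor_iff_or_and_not_and _ _ |>.1 h2).1, h1⟩
  have hdisj : Disjoint (T₁ ∩ T₂) E := by
    rw [Finset.disjoint_left]
    intro z hz hzE
    have h2 := (hE z hzE).2
    rw [← ht₁, ← ht₂] at h2
    exact (xor_iff_or_and_not_and _ _ |>.1 h2).2 (Finset.mem_inter.1 hz)
  have hcard := Finset.card_le_card hint
  rw [Finset.card_union_of_disjoint hdisj] at hcard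
  have hui := Finset.card_union_add_card_inter T₁ T₂
  have hfin : T₁.card + T₂.card + E.card ≤
      2 * (Finset.univ.image (fun x => (dickson 1 a m).eval x)).card := by omega
  have hd₁ : ((q : ℚ) - 1) / Nat.gcd m (q - 1) ≤ T₁.card := by
    rw [div_le_iff₀ (by exact_mod_cast Nat.gcd_pos_of_pos_right _ (by omega)), mul_comm,
      ← Nat.cast_one, ← Nat.cast_sub hq1.le]
    exact_mod_cast hb₁
  have hd₂ : ((q : ℚ) + 1) / Nat.gcd m (q + 1) ≤ T₂.card := by
    rw [div_le_iff₀ (by exact_mod_cast Nat.gcd_pos_of_pos_right _ (by omega)), mul_comm]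
    exact_mod_cast hb₂
  have : ((T₁.card + T₂.card + E.card : ℕ) : ℚ) ≤
      (2 * (Finset.univ.image (fun x => (dickson 1 a m).eval x)).card : ℕ) := by
    exact_mod_cast hfin
  push_cast at this
  linarith

theorem FiniteField.card_image_dickson_zero_ge {F : Type*} [Field F] [Fintype F] {q : ℕ}
    (hq : Fintype.card F = q) {m : ℕ} (hm : 0 < m) :
    ((q : ℚ) - 1) / Nat.gcd m (q - 1) + 1 ≤
      (Finset.univ.image (fun x => (dickson 1 (0 : F) m).eval x)).card := by
  have hq1 : 1 < q := hq ▸ Fintype.one_lt_card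
  have heval : ∀ x : F, (dickson 1 (0 : F) m).eval x = x ^ m := by
    intro x
    rcases eq_or_ne x 0 with rfl | hx
    · obtain ⟨k, rfl⟩ := Nat.exists_eq_succ_of_ne_zero hm.ne'
      cases k <;> simp [dickson_add_two]
    · simpa [hm.ne'] using eval_dickson_one_add_div 0 hx m
  simp only [heval]
  set S : Finset F := Finset.univ.erase 0
  have hS : S.card = q - 1 := by simp [S, hq]
  have hb := S.card_le_gcd_mul_card_image_pow one_ne_zero m (N := q - 1) (by omega)
    (fun y hy => hq ▸ FiniteField.pow_card_sub_one_eq_one y (Finset.ne_of_mem_erase hy))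
  have hsub : insert 0 (S.image (· ^ m)) ⊆ Finset.univ.image (fun x : F => x ^ m) := by
    intro z hz
    rcases Finset.mem_insert.1 hz with rfl | hz
    · exact Finset.mem_image.2 ⟨0, Finset.mem_univ _, zero_pow hm.ne'⟩
    · exact Finset.image_subset_image (Finset.subset_univ _) hz
  have hcard := Finset.card_le_card hsub
  rw [Finset.card_insert_of_notMem] at hcard
  · have hd : ((q : ℚ) - 1) / Nat.gcd m (q - 1) ≤ (S.image (· ^ m)).card := by
      rw [div_le_iff₀ (by exact_mod_cast Nat.gcd_pos_of_pos_right _ (by omega)), mul_comm,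
        ← Nat.cast_one, ← Nat.cast_sub hq1.le]
      exact_mod_cast hS ▸ hb
    have : (((S.image (· ^ m)).card + 1 : ℕ) : ℚ) ≤
      (Finset.univ.image (fun x : F => x ^ m)).card := by exact_mod_cast hcard
    push_cast at this
    linarith
  · intro h
    obtain ⟨y, hy, hy0⟩ := Finset.mem_image.1 h
    exact pow_ne_zero _ (Finset.ne_of_mem_erase hy) hy0

theorem exists_pow_eq_pow_mul_iff {K : Type*} [Field K] [IsAlgClosed K] {α χ : K} (hα : α ≠ 0)
    (hχ : χ ^ 2 = 1) {M : ℕ} (hM : α ^ M = χ) (k : ℕ) (ε : K) :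
    (∃ y : K, y ^ (2 * M) = 1 ∧ y ^ (2 * k) = α ^ k * ε) ↔ ∃ w : K, w ^ M = χ ∧ w ^ k = ε := by
  have hk := pow_ne_zero k hα
  have hχ0 : χ ≠ 0 := hM ▸ pow_ne_zero M hα
  constructor
  · rintro ⟨y, h1, h2⟩
    refine ⟨y ^ 2 / α, ?_, ?_⟩
    · rw [div_pow, ← pow_mul, h1, hM, div_eq_iff hχ0, ← hχ, sq]
    · rw [div_pow, ← pow_mul, h2, mul_div_cancel_left₀ _ hk]
  · rintro ⟨w, h1, h2⟩
    obtain ⟨y, hy⟩ := IsAlgClosed.exists_pow_nat_eq (α * w) two_pos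
    refine ⟨y, ?_, ?_⟩
    · rw [pow_mul, hy, mul_pow, h1, hM, ← hχ, sq]
    · rw [pow_mul, hy, mul_pow, h2]

theorem exists_pow_eq_self_and_pow_eq_pow_mul_iff {K : Type*} [Field K] [IsAlgClosed K] {α χ : K}
    (hα : α ≠ 0) (hχ : χ ^ 2 = 1) {M : ℕ} (hM : α ^ M = χ) (k : ℕ) (ε : K) :
    (∃ y : K, y ^ (2 * (M + 1)) = α ∧ y ^ (2 * k) = α ^ k * ε) ↔
      ∃ w : K, w ^ (M + 1) = χ ∧ w ^ k = ε := by
  have hk := pow_ne_zero k hα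
  have hχ0 : χ ≠ 0 := hM ▸ pow_ne_zero M hα
  constructor
  · rintro ⟨y, h1, h2⟩
    refine ⟨y ^ 2 / α, ?_, ?_⟩
    · rw [div_pow, ← pow_mul, h1, pow_succ, hM, div_eq_iff (mul_ne_zero hχ0 hα)]
      linear_combination -α * hχ
    · rw [div_pow, ← pow_mul, h2, mul_div_cancel_left₀ _ hk]
  · rintro ⟨w, h1, h2⟩
    obtain ⟨y, hy⟩ := IsAlgClosed.exists_pow_nat_eq (α * w) two_pos
    refine ⟨y, ?_, ?_⟩
    · rw [pow_mul, hy, mul_pow, h1, pow_succ, hM]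
      linear_combination α * hχ
    · rw [pow_mul, hy, mul_pow, h2]

theorem xor_exists_pow_eq_of_padicVal_eq {K : Type*} [Field K] [IsAlgClosed K] (h2 : (-1 : K) ≠ 1)
    {M N N' k k' e : ℕ} (hM : Odd M) (hN : N = 2 ^ e * N') (hN' : Odd N') (he : 0 < e)
    (hk : k = 2 ^ e * k') (hk' : Odd k') {ε : K} (hε : ε = 1 ∨ ε = -1) :
    Xor (∃ w : K, w ^ M = -1 ∧ w ^ k = ε) (∃ w : K, w ^ N = -1 ∧ w ^ k = ε) := by
  have hke : Even k := by
    rw [hk]; exact ((even_two.pow_of_ne_zero he.ne')).mul_right _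
  rcases hε with rfl | rfl
  · refine Or.inl ⟨⟨-1, hM.neg_one_pow, hke.neg_one_pow⟩, ?_⟩
    rintro ⟨w, h1, h3⟩
    have : (w ^ N) ^ k' = (w ^ k) ^ N' := by rw [hN, hk]; ring
    rw [h1, h3, hk'.neg_one_pow, one_pow] at this
    exact h2 this
  · refine Or.inr ⟨?_, ?_⟩
    · obtain ⟨w, hw⟩ := IsAlgClosed.exists_pow_nat_eq (-1 : K) (pow_pos two_pos e)
      exact ⟨w, by rw [hN, pow_mul, hw, hN'.neg_one_pow], by rw [hk, pow_mul, hw, hk'.neg_one_pow]⟩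
    · rintro ⟨w, h1, h3⟩
      have : (w ^ M) ^ k = (w ^ k) ^ M := by ring
      rw [h1, h3, hke.neg_one_pow, hM.neg_one_pow] at this
      exact h2 this.symm

theorem exists_xor_exists_pow_eq_of_padicVal_lt {K : Type*} [Field K] [IsAlgClosed K]
    (h2 : (-1 : K) ≠ 1) {M N N' k k' e f : ℕ} (hM : Odd M) (hN : N = 2 ^ e * N') (hfe : f < e)
    (hk : k = 2 ^ f * k') (hk' : Odd k') {χ : K} (hχ : χ = 1 ∨ χ = -1) :
    ∃ ε : K, ε ^ 2 = 1 ∧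
      Xor (∃ w : K, w ^ M = χ ∧ w ^ k = ε) (∃ w : K, w ^ N = χ ∧ w ^ k = ε) := by
  obtain ⟨g, rfl⟩ := Nat.exists_eq_add_of_lt hfe
  rcases hχ with rfl | rfl
  · refine ⟨-1, by norm_num, Or.inr ⟨?_, ?_⟩⟩
    · obtain ⟨w, hw⟩ := IsAlgClosed.exists_pow_nat_eq (-1 : K) (pow_pos two_pos f)
      refine ⟨w, ?_, by rw [hk, pow_mul, hw, hk'.neg_one_pow]⟩
      rw [hN, show 2 ^ (f + g + 1) * N' = 2 ^ f * (2 * (2 ^ g * N')) by ring, pow_mul, hw,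
        pow_mul, neg_one_sq, one_pow]
    · rintro ⟨w, h1, h3⟩
      have : (w ^ M) ^ k = (w ^ k) ^ M := by ring
      rw [h1, h3, one_pow, hM.neg_one_pow] at this
      exact h2 this.symm
  · refine ⟨(-1) ^ k, by rw [← pow_mul, mul_comm, pow_mul, neg_one_sq, one_pow],
      Or.inl ⟨⟨-1, hM.neg_one_pow, rfl⟩, ?_⟩⟩
    rintro ⟨w, h1, h3⟩
    have : (w ^ N) ^ k' = ((w ^ k) ^ 2) ^ (2 ^ g * N') := by rw [hN, hk]; ring
    rw [h1, h3, hk'.neg_one_pow, ← pow_mul (-1), mul_comm k, pow_mul (-1), neg_one_sq, one_pow,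
      one_pow] at this
    exact h2 this

theorem Nat.eq_of_two_pow_exactly_dvd {n r e c : ℕ} (hr : 2 ^ r ∣ n ∧ ¬ 2 ^ (r + 1) ∣ n)
    (hn : n = 2 ^ e * c) (hc : Odd c) : r = e := by
  subst hn
  have h1 : 2 ^ r ∣ 2 ^ e := (Nat.Coprime.pow_left r hc.coprime_two_left).dvd_of_dvd_mul_right hr.1
  have h2 := (Nat.pow_dvd_pow_iff_le_right (by norm_num)).1 h1
  by_contra h
  exact hr.2 ((pow_dvd_pow 2 (by omega)).mul_right c)

theorem FiniteField.xor_exists_pow_eq_of_nonsquare {F K : Type*} [Field F] [Fintype F] [Field K]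
    [IsAlgClosed K] [Algebra F K] {q r : ℕ} (hq : Fintype.card F = q) (hodd : Odd q)
    (hr : 2 ^ r ∣ q ^ 2 - 1 ∧ ¬ 2 ^ (r + 1) ∣ q ^ 2 - 1) {a : F} (ha : a ≠ 0) {m : ℕ}
    (hm0 : 0 < m) :
    ((2 ^ (r - 1) ∣ m ∧ ¬ 2 ^ r ∣ m) ∧ (¬ ∃ u : F, a = u ^ 2) →
      ∃ z z' : K, z ≠ z' ∧ ∀ x, x = z ∨ x = z' → x ^ 2 = algebraMap F K a ^ m ∧
        Xor (∃ y : K, y ^ (q - 1) = 1 ∧ y ^ m = x)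
          (∃ y : K, y ^ (q + 1) = algebraMap F K a ∧ y ^ m = x)) ∧
    (Even m ∧ ¬ 2 ^ (r - 1) ∣ m →
      ∃ z : K, z ^ 2 = algebraMap F K a ^ m ∧
        Xor (∃ y : K, y ^ (q - 1) = 1 ∧ y ^ m = z)
          (∃ y : K, y ^ (q + 1) = algebraMap F K a ∧ y ^ m = z)) := by
  obtain ⟨M, hM⟩ := hodd
  have hq1 : 1 < q := hq ▸ Fintype.one_lt_card
  have hMpos : M ≠ 0 := by omega
  have hchar : ringChar F ≠ 2 := by
    intro h
    have := FiniteField.even_card_iff_char_two.1 h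
    omega
  have h2 : (-1 : K) ≠ 1 := by
    intro h
    apply Ring.neg_one_ne_one_of_char_ne_two hchar
    apply (algebraMap F K).injective
    simpa using h
  set α := algebraMap F K a with hα
  have hα0 : α ≠ 0 := by simpa [hα] using ha
  have hqM : Fintype.card F / 2 = M := by omega
  have hdich : α ^ M = 1 ∨ α ^ M = -1 := by
    rcases FiniteField.pow_dichotomy hchar ha with h | h <;> rw [hqM] at h
    · left; rw [hα, ← map_pow, h, map_one]
    · right; rw [hα, ← map_pow, h, map_neg, map_one]
  have hnonsq : (¬ ∃ u : F, a = u ^ 2) → α ^ M = -1 := by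
    intro h
    refine hdich.resolve_left fun h1 => h ?_
    have : a ^ (Fintype.card F / 2) = 1 := by
      apply (algebraMap F K).injective
      rw [hqM, map_pow, ← hα, h1, map_one]
    obtain ⟨u, hu⟩ := (FiniteField.isSquare_iff hchar ha).2 this
    exact ⟨u, by rw [hu, sq]⟩
  have hχ : (α ^ M) ^ 2 = 1 := by rcases hdich with h | h <;> simp [h]
  have hset : ∀ (k : ℕ) (ε : K),
      Xor (∃ w : K, w ^ M = α ^ M ∧ w ^ k = ε) (∃ w : K, w ^ (M + 1) = α ^ M ∧ w ^ k = ε) →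
      Xor (∃ y : K, y ^ (q - 1) = 1 ∧ y ^ (2 * k) = α ^ k * ε)
          (∃ y : K, y ^ (q + 1) = α ∧ y ^ (2 * k) = α ^ k * ε) := by
    intro k ε h
    rw [← exists_pow_eq_pow_mul_iff hα0 hχ rfl,
      ← exists_pow_eq_self_and_pow_eq_pow_mul_iff hα0 hχ rfl] at h
    rwa [show q - 1 = 2 * M by omega, show q + 1 = 2 * (M + 1) by omega]
  obtain ⟨A, B, B', e, hA, hB, hB', he, hprod, hAB⟩ : ∃ A B B' e : ℕ, Odd A ∧ B = 2 ^ e * B' ∧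
      Odd B' ∧ 0 < e ∧ A * B = M * (M + 1) ∧ ∀ χ ε : K, ∀ k : ℕ,
      Xor (∃ w : K, w ^ A = χ ∧ w ^ k = ε) (∃ w : K, w ^ B = χ ∧ w ^ k = ε) →
      Xor (∃ w : K, w ^ M = χ ∧ w ^ k = ε) (∃ w : K, w ^ (M + 1) = χ ∧ w ^ k = ε) := by
    have hpos : ∀ {e B B' : ℕ}, B = 2 ^ e * B' → Odd B' → Even B → 0 < e := by
      rintro e B B' rfl hB' h
      refine Nat.pos_of_ne_zero ?_
      rintro rfl
      rw [pow_zero, one_mul] at h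
      exact (Nat.not_even_iff_odd.2 hB') h
    rcases Nat.even_or_odd M with h | h
    · obtain ⟨e, B', hB', hB⟩ := Nat.exists_eq_two_pow_mul_odd hMpos
      exact ⟨M + 1, M, B', e, h.add_one, hB, hB', hpos hB hB' h, mul_comm _ _,
        fun χ ε k h => by rwa [xor_comm]⟩
    · obtain ⟨e, B', hB', hB⟩ := Nat.exists_eq_two_pow_mul_odd (Nat.succ_ne_zero M)
      exact ⟨M, M + 1, B', e, h, hB, hB', hpos hB hB' h.add_one, rfl, fun χ ε k h => h⟩
  obtain rfl : r = e + 2 := by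
    refine Nat.eq_of_two_pow_exactly_dvd hr (c := A * B') ?_ (hA.mul hB')
    have h1 : q ^ 2 = 4 * (M * (M + 1)) + 1 := by rw [hM]; ring
    rw [h1, ← hprod, hB, Nat.add_sub_cancel]
    ring
  rw [show e + 2 - 1 = e + 1 by omega]
  constructor
  · rintro ⟨⟨⟨k', rfl⟩, hm2⟩, hns⟩
    have hk' : Odd k' := by
      by_contra h
      obtain ⟨l, rfl⟩ := (Nat.not_odd_iff_even.1 h).two_dvd
      exact hm2 ⟨l, by ring⟩
    have hαM := hnonsq hns
    have hm : 2 ^ (e + 1) * k' = 2 * (2 ^ e * k') := by ring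
    rw [hm]
    set k := 2 ^ e * k' with hk
    have hkα : α ^ k ≠ 0 := pow_ne_zero _ hα0
    have key : ∀ ε : K, ε = 1 ∨ ε = -1 → (α ^ k * ε) ^ 2 = α ^ (2 * k) ∧
        Xor (∃ y : K, y ^ (q - 1) = 1 ∧ y ^ (2 * k) = α ^ k * ε)
          (∃ y : K, y ^ (q + 1) = α ∧ y ^ (2 * k) = α ^ k * ε) := by
      intro ε hε
      refine ⟨?_, hset k ε (hAB _ _ _ ?_)⟩
      · rcases hε with rfl | rfl <;> ring
      · rw [hαM]
        exact xor_exists_pow_eq_of_padicVal_eq h2 hA hB hB' he hk hk' hε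
    refine ⟨α ^ k * 1, α ^ k * (-1), fun h => h2 (mul_left_cancel₀ hkα h).symm, ?_⟩
    rintro x (rfl | rfl)
    exacts [key 1 (Or.inl rfl), key (-1) (Or.inr rfl)]
  · rintro ⟨hme, hm2⟩
    obtain ⟨k, rfl⟩ := hme.two_dvd
    obtain ⟨f, k', hk', hk⟩ := Nat.exists_eq_two_pow_mul_odd (n := k) (by omega)
    have hfe : f < e := by
      by_contra h
      apply hm2
      rw [hk, pow_succ']
      exact mul_dvd_mul_left 2 ((pow_dvd_pow 2 (by omega)).mul_right k')
    obtain ⟨ε, hε, hx⟩ := exists_xor_exists_pow_eq_of_padicVal_lt h2 hA hB hfe hk hk' hdich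
    exact ⟨α ^ k * ε, by rw [mul_pow, hε, ← pow_mul, mul_one, mul_comm k], hset k ε (hAB _ _ _ hx)⟩

end DicksonValueSet

theorem FiniteField.card_image_dickson_ge_add_defect {F : Type*} [Field F] [Fintype F] {q r : ℕ}
    (hq : Fintype.card F = q) (hr : 2 ^ r ∣ q ^ 2 - 1 ∧ ¬ 2 ^ (r + 1) ∣ q ^ 2 - 1) {a : F}
    (ha : a ≠ 0) {m : ℕ} (hm : 0 < m) :
    ((q : ℚ) - 1) / Nat.gcd m (q - 1) / 2 + ((q : ℚ) + 1) / Nat.gcd m (q + 1) / 2 +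
      (if Odd q ∧ (2 ^ (r - 1) ∣ m ∧ ¬ 2 ^ r ∣ m) ∧ ¬ ∃ u : F, a = u ^ 2 then 1
      else if Odd q ∧ Even m ∧ ¬ 2 ^ (r - 1) ∣ m then 1 / 2
      else 0) ≤
      (Finset.univ.image (fun x => (Polynomial.dickson 1 a m).eval x)).card := by
  have key := FiniteField.card_image_dickson_ge (K := AlgebraicClosure F) hq ha m
  split_ifs with h1 h2
  · obtain ⟨z, z', hne, hz⟩ := (FiniteField.xor_exists_pow_eq_of_nonsquare
      (K := AlgebraicClosure F) hq h1.1 hr ha hm).1 h1.2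
    have := key {z, z'} (by simpa using hz)
    rw [Finset.card_pair hne] at this
    push_cast at this
    linarith
  · obtain ⟨z, hz⟩ := (FiniteField.xor_exists_pow_eq_of_nonsquare
      (K := AlgebraicClosure F) hq h2.1 hr ha hm).2 h2.2
    have := key {z} (by simpa using hz)
    rw [Finset.card_singleton] at this
    push_cast at this
    linarith
  · have := key ∅ (by simp)
    rw [Finset.card_empty] at this
    push_cast at this
    linarith

theorem Finset.sum_card_image_sub_one_lt_card_of_unique_sum {G X : Type*} [AddCommGroup G]
    [Fintype G] [Fintype X] {n : ℕ} (g : Fin n → X → G) (x₀ : Fin n → X)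
    (huniq : ∀ x : Fin n → X, ∑ j, g j (x j) = ∑ j, g j (x₀ j) → x = x₀) :
    ∑ j, ((Finset.univ.image (g j)).card - 1) < Fintype.card G := by
  set A : Fin n → Finset G := fun j => Finset.univ.image fun x => g j x - g j (x₀ j)
  have hcard : ∀ j, (A j).card = (Finset.univ.image (g j)).card := by
    intro j
    rw [← Finset.card_image_of_injective (Finset.univ.image (g j))
      (sub_left_injective (b := g j (x₀ j))), Finset.image_image]
    rfl
  have h := Finset.sum_card_sub_one_lt_card_of_unique_zero Finset.univ A
    (fun j _ => Finset.mem_image.2 ⟨x₀ j, Finset.mem_univ _, sub_self _⟩) (by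
      intro f hf hsum j hj
      choose x _ hx using fun j => Finset.mem_image.1 (hf j (Finset.mem_univ j))
      have : x = x₀ := huniq x (by
        rw [← sub_eq_zero, ← Finset.sum_sub_distrib, ← hsum]
        exact Finset.sum_congr rfl fun j _ => hx j)
      rw [← hx j, this, sub_self])
  simp only [hcard] at h
  exact h.trans_le (Finset.card_le_univ _)

/-- Theorem 2: equations with Dickson polynomials. -/
theorem stmt_14 (F : Type*) [Field F] [Fintype F] (q r n t : ℕ) (hq : Fintype.card F = q)
    (htn : t ≤ n) (hr : 2 ^ r ∣ q ^ 2 - 1 ∧ ¬ 2 ^ (r + 1) ∣ q ^ 2 - 1)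
    (m : Fin n → ℕ) (hm : ∀ j, 0 < m j)
    (b : Fin n → F) (hb : ∀ j, b j ≠ 0) (c : F)
    (a : Fin n → F) (ha0 : ∀ j : Fin n, (j : ℕ) < t → a j = 0)
    (ha : ∀ j : Fin n, t ≤ (j : ℕ) → a j ≠ 0)
    (δ : Fin n → ℚ)
    (hδ : ∀ j, δ j =
      if Odd q ∧ (2 ^ (r - 1) ∣ m j ∧ ¬ 2 ^ r ∣ m j) ∧ ¬ ∃ u : F, a j = u ^ 2 then 1
      else if Odd q ∧ Even (m j) ∧ ¬ 2 ^ (r - 1) ∣ m j then 1 / 2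
      else 0)
    (hineq : (1 : ℚ) + ((n : ℚ) - t - ∑ j ∈ Finset.univ.filter (fun j : Fin n => t ≤ (j : ℕ)), δ j) / (q - 1)
      < ∑ j ∈ Finset.univ.filter (fun j : Fin n => (j : ℕ) < t), (1 : ℚ) / Nat.gcd (m j) (q - 1)
        + (1 / 2) * ∑ j ∈ Finset.univ.filter (fun j : Fin n => t ≤ (j : ℕ)), (1 : ℚ) / Nat.gcd (m j) (q - 1)
        + (1 / 2 + 1 / (q - 1)) * ∑ j ∈ Finset.univ.filter (fun j : Fin n => t ≤ (j : ℕ)), (1 : ℚ) / Nat.gcd (m j) (q + 1))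
    (hsol : ∃ x : Fin n → F, ∑ j, b j * (Polynomial.dickson 1 (a j) (m j)).eval (x j) = c) :
    ∃ x y : Fin n → F, x ≠ y ∧
      ∑ j, b j * (Polynomial.dickson 1 (a j) (m j)).eval (x j) = c ∧
      ∑ j, b j * (Polynomial.dickson 1 (a j) (m j)).eval (y j) = c := by
  by_contra hcon
  push Not at hcon
  obtain ⟨x₀, hx₀⟩ := hsol
  have hq1 : 1 < q := hq ▸ Fintype.one_lt_card
  have hqQ : (0 : ℚ) < q - 1 := by
    rw [sub_pos]; exact_mod_cast hq1
  set V : Fin n → Finset F := fun j =>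
    Finset.univ.image fun x => (Polynomial.dickson 1 (a j) (m j)).eval x
  have hVpos : ∀ j, 1 ≤ (V j).card := fun j =>
    Finset.card_pos.2 (Finset.univ_nonempty.image _)
  have hupper : ∑ j, ((V j).card - 1) < q := by
    have h := Finset.sum_card_image_sub_one_lt_card_of_unique_sum
      (fun j x => b j * (Polynomial.dickson 1 (a j) (m j)).eval x) x₀ (by
        intro x hx
        by_contra hne
        exact hcon x x₀ hne (hx.trans hx₀) hx₀)
    have hcard : ∀ j, (Finset.univ.image
        fun x => b j * (Polynomial.dickson 1 (a j) (m j)).eval x).card = (V j).card := by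
      intro j
      rw [← Finset.card_image_of_injective (V j) (mul_right_injective₀ (hb j)),
        Finset.image_image]
      rfl
    simpa only [hcard, hq] using h
  have hupperQ : ∑ j, (((V j).card : ℚ) - 1) ≤ q - 1 := by
    have h : ((∑ j, ((V j).card - 1) + 1 : ℕ) : ℚ) ≤ q := by exact_mod_cast hupper
    push_cast [Nat.cast_sub (hVpos _)] at h
    linarith
  have hsmall : ∀ j ∈ Finset.univ.filter (fun j : Fin n => (j : ℕ) < t),
      ((q : ℚ) - 1) * (1 / Nat.gcd (m j) (q - 1)) ≤ (V j).card - 1 := by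
    intro j hj
    have h := FiniteField.card_image_dickson_zero_ge hq (hm j)
    rw [← ha0 j (Finset.mem_filter.1 hj).2] at h
    rw [mul_one_div]
    linarith
  have hlarge : ∀ j ∈ Finset.univ.filter (fun j : Fin n => t ≤ (j : ℕ)),
      ((q : ℚ) - 1) / 2 * (1 / Nat.gcd (m j) (q - 1)) +
        ((q : ℚ) + 1) / 2 * (1 / Nat.gcd (m j) (q + 1)) + δ j - 1 ≤ (V j).card - 1 := by
    intro j hj
    have h := FiniteField.card_image_dickson_ge_add_defect hq hr
      (ha j (Finset.mem_filter.1 hj).2) (hm j)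
    rw [← hδ j] at h
    rw [mul_one_div, mul_one_div, div_right_comm, div_right_comm ((q : ℚ) + 1)]
    linarith
  have hnot : Finset.univ.filter (fun j : Fin n => t ≤ (j : ℕ)) =
      Finset.univ.filter (fun j : Fin n => ¬ (j : ℕ) < t) :=
    Finset.filter_congr fun j _ => not_lt.symm
  have hcount : ((Finset.univ.filter (fun j : Fin n => t ≤ (j : ℕ))).card : ℚ) = n - t := by
    have h1 := Finset.card_filter_add_card_filter_not (s := (Finset.univ : Finset (Fin n)))
      (fun j : Fin n => (j : ℕ) < t)
    rw [← hnot, Fin.card_filter_val_lt, min_eq_right htn, Finset.card_univ,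
      Fintype.card_fin] at h1
    rw [eq_sub_iff_add_eq', ← Nat.cast_add, h1]
  have hS := Finset.sum_le_sum hsmall
  have hL := Finset.sum_le_sum hlarge
  have hsplit := Finset.sum_filter_add_sum_filter_not Finset.univ
    (fun j : Fin n => (j : ℕ) < t) (fun j => ((V j).card : ℚ) - 1)
  rw [← hnot] at hsplit
  rw [← Finset.mul_sum] at hS
  rw [Finset.sum_sub_distrib, Finset.sum_add_distrib, Finset.sum_add_distrib, ← Finset.mul_sum,
    ← Finset.mul_sum, Finset.sum_const, nsmul_eq_mul, mul_one, hcount] at hL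
  have hmul := mul_lt_mul_of_pos_right hineq hqQ
  have hcoef : (1 / 2 + 1 / ((q : ℚ) - 1)) * (q - 1) = (q + 1) / 2 := by
    field_simp
    ring
  rw [add_mul, add_mul, add_mul, div_mul_cancel₀ _ hqQ.ne', mul_right_comm (1 / 2 + _) _ ((q : ℚ) - 1),
    hcoef] at hmul
  linarith
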